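/- Characterization of conditional independence: let X be an ℝ^p-valued random vector, Z an ℝ^r-valued random vector, and Y = (Y_1,…,Y_q) an ℝ^q-valued random vector with non-degenerate components, all defined on a common probability space. Then T(Y|X) = T(Y|(X,Z)) if and only if Y and Z are conditionally independent given X. -/

import Mathlib

open MeasureTheory ProbabilityTheory

/-- Azadkia–Chatterjee's rank correlation `ξ(Y | m)` of a real random variable `Y`
given a sub-σ-algebra `m`. -/
noncomputable def xiSigma {Ω : Type*} (m : MeasurableSpace Ω) [MeasurableSpace Ω]
    (P : Measure Ω) (Y : Ω → ℝ) : ℝ :=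
  (∫ y, variance (P[Set.indicator {ω | y ≤ Y ω} (fun _ => (1 : ℝ)) | m]) P ∂(P.map Y)) /
  (∫ y, variance (Set.indicator {ω | y ≤ Y ω} (fun _ => (1 : ℝ))) P ∂(P.map Y))

/-- Azadkia–Chatterjee's rank correlation `ξ(Y | X)`: conditioning on the σ-algebra
generated by the random vector `X`. -/
noncomputable def xi {Ω α : Type*} [MeasurableSpace Ω] [MeasurableSpace α]
    (P : Measure Ω) (Y : Ω → ℝ) (X : Ω → α) : ℝ :=
  xiSigma (MeasurableSpace.comap X inferInstance) P Y

/-- The σ-algebra generated by the response variables with index `< i`,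
i.e. by `(Y_1, …, Y_{i-1})`; for `i = 0` it is the trivial σ-algebra `⊥`,
so that `xiSigma (sigmaPast Y 0) P (Y 0) = ξ(Y_1 | ∅) = 0`. -/
def sigmaPast {Ω : Type*} {q : ℕ} (Y : Fin q → Ω → ℝ) (i : Fin q) :
    MeasurableSpace Ω :=
  ⨆ j : Fin q, ⨆ _ : j < i, MeasurableSpace.comap (Y j) inferInstance

/-- The extension `T(Y | X)` of Azadkia–Chatterjee's rank correlation to a vector
`Y = (Y_1, …, Y_q)` of response variables, given the predictor vector `X`:
`T(Y|X) = 1 − (q − ∑_i ξ(Y_i | (X,Y_{i−1},…,Y_1))) / (q − ∑_i ξ(Y_i | (Y_{i−1},…,Y_1)))`. -/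
noncomputable def T {Ω α : Type*} [MeasurableSpace Ω] [MeasurableSpace α]
    (P : Measure Ω) {q : ℕ} (Y : Fin q → Ω → ℝ) (X : Ω → α) : ℝ :=
  1 - ((q : ℝ) - ∑ i, xiSigma (MeasurableSpace.comap X inferInstance ⊔ sigmaPast Y i) P (Y i)) /
      ((q : ℝ) - ∑ i, xiSigma (sigmaPast Y i) P (Y i))

/-- A real random variable is non-degenerate if it is not almost surely constant. -/
def Nondegenerate {Ω : Type*} [MeasurableSpace Ω] (P : Measure Ω) (Y : Ω → ℝ) : Prop :=
  ¬ ∃ c : ℝ, ∀ᵐ ω ∂P, Y ω = c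


open Filter Topology
open scoped ENNReal

section CondExpIndicator

variable {Ω : Type*} {m A B m₀ : MeasurableSpace Ω} {μ : Measure Ω}

lemma indicator_one_inter_eq_mul (s t : Set Ω) :
    (s ∩ t).indicator (fun _ => (1 : ℝ)) =
      s.indicator (fun _ => (1 : ℝ)) * t.indicator (fun _ => (1 : ℝ)) := by
  ext ω; by_cases h : ω ∈ s <;> by_cases h' : ω ∈ t <;> simp [h, h']

lemma mul_indicator_one (f : Ω → ℝ) (t : Set Ω) :
    f * t.indicator (fun _ => (1 : ℝ)) = t.indicator f := by
  ext ω; by_cases h : ω ∈ t <;> simp [h]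

variable [IsFiniteMeasure μ]

lemma integrable_indicator_one {s : Set Ω} (hs : MeasurableSet s) :
    Integrable (s.indicator (fun _ => (1 : ℝ))) μ :=
  (integrable_const 1).indicator hs

/-- If conditioning additionally on `B` does not change `P(s | m)`, then `s` is conditionally
independent of `B` given `m`. -/
lemma condExp_inter_of_condExp_sup (hm : m ≤ m₀) (hB : B ≤ m₀) {s t : Set Ω}
    (hs : MeasurableSet s) (ht : MeasurableSet[B] t)
    (h : μ⟦s | m ⊔ B⟧ =ᵐ[μ] μ⟦s | m⟧) :
    μ⟦s ∩ t | m⟧ =ᵐ[μ] μ⟦s | m⟧ * μ⟦t | m⟧ := by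
  have hsup : m ⊔ B ≤ m₀ := sup_le hm hB
  have ht' : MeasurableSet[m ⊔ B] t := (le_sup_right : B ≤ m ⊔ B) t ht
  have hint := integrable_indicator_one (μ := μ) (hs.inter (hB t ht))
  have h1 : μ[μ⟦s ∩ t | m ⊔ B⟧ | m] =ᵐ[μ] μ⟦s ∩ t | m⟧ :=
    condExp_condExp_of_le le_sup_left hsup
  have h2 : μ⟦s ∩ t | m ⊔ B⟧ =ᵐ[μ] μ⟦s | m ⊔ B⟧ * t.indicator (fun _ => (1 : ℝ)) := by
    rw [indicator_one_inter_eq_mul] at hint ⊢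
    exact condExp_mul_of_stronglyMeasurable_right
      (stronglyMeasurable_const.indicator ht') hint (integrable_indicator_one hs)
  have h3 : μ⟦s ∩ t | m ⊔ B⟧ =ᵐ[μ] μ⟦s | m⟧ * t.indicator (fun _ => (1 : ℝ)) := by
    filter_upwards [h2, h] with ω h2 h
    rw [h2, Pi.mul_apply, Pi.mul_apply, h]
  refine h1.symm.trans ((condExp_congr_ae h3).trans ?_)
  refine condExp_mul_of_stronglyMeasurable_left stronglyMeasurable_condExp ?_
    (integrable_indicator_one (hB t ht))
  rw [mul_indicator_one]
  exact integrable_condExp.indicator (hB t ht)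

lemma isPiSystem_inter_measurableSet (m B : MeasurableSpace Ω) :
    IsPiSystem {w : Set Ω | ∃ u v, MeasurableSet[m] u ∧ MeasurableSet[B] v ∧ u ∩ v = w} := by
  rintro _ ⟨u, v, hu, hv, rfl⟩ _ ⟨u', v', hu', hv', rfl⟩ -
  exact ⟨u ∩ u', v ∩ v', hu.inter hu', hv.inter hv', Set.inter_inter_inter_comm _ _ _ _⟩

lemma sup_eq_generateFrom_inter (m B : MeasurableSpace Ω) :
    m ⊔ B = MeasurableSpace.generateFrom
      {w : Set Ω | ∃ u v, MeasurableSet[m] u ∧ MeasurableSet[B] v ∧ u ∩ v = w} := by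
  apply le_antisymm
  · refine sup_le (fun u hu => ?_) (fun v hv => ?_)
    · exact MeasurableSpace.measurableSet_generateFrom ⟨u, Set.univ, hu, .univ, by simp⟩
    · exact MeasurableSpace.measurableSet_generateFrom ⟨Set.univ, v, .univ, hv, by simp⟩
  · refine MeasurableSpace.generateFrom_le ?_
    rintro _ ⟨u, v, hu, hv, rfl⟩
    exact MeasurableSet.inter ((le_sup_left : m ≤ m ⊔ B) u hu) ((le_sup_right : B ≤ m ⊔ B) v hv)

/-- If `s` is conditionally independent of `B` given `m`, then conditioning additionally on `B`
does not change `P(s | m)`. -/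
lemma condExp_sup_of_condExp_inter (hm : m ≤ m₀) (hB : B ≤ m₀) {s : Set Ω}
    (hs : MeasurableSet s)
    (h : ∀ t, MeasurableSet[B] t → μ⟦s ∩ t | m⟧ =ᵐ[μ] μ⟦s | m⟧ * μ⟦t | m⟧) :
    μ⟦s | m ⊔ B⟧ =ᵐ[μ] μ⟦s | m⟧ := by
  have hsup : m ⊔ B ≤ m₀ := sup_le hm hB
  have hsint := integrable_indicator_one (μ := μ) hs
  have key : ∀ w, MeasurableSet[m ⊔ B] w →
      ∫ ω in w, (μ⟦s | m⟧) ω ∂μ = ∫ ω in w, s.indicator (fun _ => (1 : ℝ)) ω ∂μ := by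
    intro w hw
    induction w, hw using MeasurableSpace.induction_on_inter
      (sup_eq_generateFrom_inter m B) (isPiSystem_inter_measurableSet m B) with
    | empty => simp
    | basic w hw =>
      obtain ⟨u, v, hu, hv, rfl⟩ := hw
      have hv' := hB v hv
      have hprod : Integrable (μ⟦s | m⟧ * v.indicator (fun _ => (1 : ℝ))) μ := by
        rw [mul_indicator_one]; exact integrable_condExp.indicator hv'
      have h1 : μ[μ⟦s | m⟧ * v.indicator (fun _ => (1 : ℝ)) | m] =ᵐ[μ] μ⟦s ∩ v | m⟧ :=
        (condExp_mul_of_stronglyMeasurable_left stronglyMeasurable_condExp hprod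
          (integrable_indicator_one hv')).trans (h v hv).symm
      have h2 := setIntegral_condExp hm hprod hu
      have h3 := setIntegral_condExp hm (integrable_indicator_one (μ := μ) (hs.inter hv')) hu
      rw [setIntegral_congr_ae (hm u hu) (h1.mono fun _ hx _ => hx), h3, mul_indicator_one,
        indicator_one_inter_eq_mul, mul_indicator_one, setIntegral_indicator hv',
        setIntegral_indicator hv'] at h2
      exact h2.symm
    | compl w hw ih =>
      have hw' := hsup w hw
      have h1 := integral_add_compl hw' (integrable_condExp (μ := μ) (m := m)
        (f := s.indicator fun _ => (1 : ℝ)))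
      have h2 := integral_add_compl hw' hsint
      rw [integral_condExp hm] at h1
      linarith
    | iUnion f hd hf ih =>
      rw [integral_iUnion (fun i => hsup _ (hf i)) hd integrable_condExp.integrableOn,
        integral_iUnion (fun i => hsup _ (hf i)) hd hsint.integrableOn]
      exact tsum_congr ih
  have hsm : StronglyMeasurable[m ⊔ B] (μ⟦s | m⟧) := stronglyMeasurable_condExp.mono le_sup_left
  exact (ae_eq_condExp_of_forall_setIntegral_eq hsup hsint
    (fun _ _ _ => integrable_condExp.integrableOn) (fun w hw _ => key w hw)
    hsm.aestronglyMeasurable).symm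

lemma condIndep_iff_condExp_sup [StandardBorelSpace Ω] (hm : m ≤ m₀)
    (hA : A ≤ m₀) (hB : B ≤ m₀) :
    CondIndep m A B hm μ ↔
      ∀ s, MeasurableSet[A] s → μ⟦s | m ⊔ B⟧ =ᵐ[μ] μ⟦s | m⟧ := by
  rw [condIndep_iff m A B hm hA hB]
  exact ⟨fun h s hs => condExp_sup_of_condExp_inter hm hB (hA s hs) fun t ht => h s t hs ht,
    fun h s t hs ht => condExp_inter_of_condExp_sup hm hB (hA s hs) ht (h s hs)⟩

/-- It suffices to test conditional independence of `Y` on the events `{y ≤ Y}`. -/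
lemma condIndep_comap_of_forall_condExp_sup [StandardBorelSpace Ω] {Y : Ω → ℝ}
    (hY : Measurable Y) (hm : m ≤ m₀) (hB : B ≤ m₀)
    (h : ∀ y, μ⟦{ω | y ≤ Y ω} | m ⊔ B⟧ =ᵐ[μ] μ⟦{ω | y ≤ Y ω} | m⟧) :
    CondIndep m (MeasurableSpace.comap Y inferInstance) B hm μ := by
  have hmeas : ∀ y, MeasurableSet {ω | y ≤ Y ω} := fun y => measurableSet_le measurable_const hY
  refine CondIndepSets.condIndep (p1 := Set.range fun y => {ω | y ≤ Y ω})
    (p2 := {t | MeasurableSet[B] t}) hY.comap_le hB ?_ (@MeasurableSpace.isPiSystem_measurableSet _ B)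
    ?_ (@MeasurableSpace.generateFrom_measurableSet _ B).symm ?_
  · rintro _ ⟨a, rfl⟩ _ ⟨b, rfl⟩ -
    exact ⟨max a b, by ext ω; simp⟩
  · rw [BorelSpace.measurable_eq (α := ℝ), borel_eq_generateFrom_Ici,
      MeasurableSpace.comap_generateFrom, ← Set.range_comp]
    rfl
  · rw [condIndepSets_iff m hm (Set.range _) {t | MeasurableSet[B] t} (by rintro _ ⟨y, rfl⟩; exact hmeas y) (fun t ht => hB t ht)]
    rintro _ t ⟨y, rfl⟩ ht
    exact condExp_inter_of_condExp_sup hm hB (hmeas y) ht (h y)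

end CondExpIndicator

section CondExpVariance

variable {Ω : Type*} {m m' m₀ : MeasurableSpace Ω} {μ : Measure Ω} [IsProbabilityMeasure μ]

lemma integral_sq_sub_condExp_add_variance_condExp (hmm' : m ≤ m') (hm' : m' ≤ m₀) {f : Ω → ℝ}
    (hf : MemLp f 2 μ) :
    ∫ ω, ((μ[f | m']) ω - (μ[f | m]) ω) ^ 2 ∂μ + variance (μ[f | m]) μ =
      variance (μ[f | m']) μ := by
  have hg : MemLp (μ[f | m']) 2 μ := hf.condExp (by norm_num)
  have htower : μ[μ[f | m'] | m] =ᵐ[μ] μ[f | m] := condExp_condExp_of_le hmm' hm'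
  rw [← integral_condVar_add_variance_condExp (hmm'.trans hm') hg, variance_congr htower, condVar,
    integral_condExp (hmm'.trans hm')]
  congr 1
  refine integral_congr_ae ?_
  filter_upwards [htower] with ω hω
  simp [hω]

lemma variance_condExp_mono (hmm' : m ≤ m') (hm' : m' ≤ m₀) {f : Ω → ℝ} (hf : MemLp f 2 μ) :
    variance (μ[f | m]) μ ≤ variance (μ[f | m']) μ := by
  rw [← integral_sq_sub_condExp_add_variance_condExp hmm' hm' hf]
  exact le_add_of_nonneg_left (integral_nonneg fun _ => sq_nonneg _)

lemma variance_condExp_eq_iff (hmm' : m ≤ m') (hm' : m' ≤ m₀) {f : Ω → ℝ} (hf : MemLp f 2 μ) :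
    variance (μ[f | m]) μ = variance (μ[f | m']) μ ↔ μ[f | m'] =ᵐ[μ] μ[f | m] := by
  refine ⟨fun h => ?_, fun h => (variance_congr h).symm⟩
  have hsum := integral_sq_sub_condExp_add_variance_condExp hmm' hm' hf
  have hint : Integrable (fun ω => ((μ[f | m']) ω - (μ[f | m]) ω) ^ 2) μ :=
    ((hf.condExp (m := m') (by norm_num)).sub (hf.condExp (m := m) (by norm_num))).integrable_sq
  have hzero : ∫ ω, ((μ[f | m']) ω - (μ[f | m]) ω) ^ 2 ∂μ = 0 := by linarith
  rw [integral_eq_zero_iff_of_nonneg (fun _ => sq_nonneg _) hint] at hzero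
  filter_upwards [hzero] with ω hω
  exact sub_eq_zero.mp (pow_eq_zero_iff two_ne_zero |>.mp hω)

lemma memLp_indicator_one {s : Set Ω} (hs : MeasurableSet s) :
    MemLp (s.indicator (fun _ => (1 : ℝ))) 2 μ :=
  (memLp_const 1).indicator hs

omit [IsProbabilityMeasure μ] in
lemma condExp_indicator_one_nonneg (s : Set Ω) : 0 ≤ᵐ[μ] μ⟦s | m⟧ :=
  condExp_nonneg (Eventually.of_forall fun _ => Set.indicator_nonneg (fun _ _ => zero_le_one) _)

lemma condExp_indicator_one_mono {s t : Set Ω} (hs : MeasurableSet s) (ht : MeasurableSet t)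
    (hst : s ⊆ t) : μ⟦s | m⟧ ≤ᵐ[μ] μ⟦t | m⟧ :=
  condExp_mono (integrable_indicator_one hs) (integrable_indicator_one ht)
    (Eventually.of_forall (Set.indicator_le_indicator_of_subset hst fun _ => zero_le_one))

lemma integrable_variance_condExp (hm : m ≤ m₀) {Y : Ω → ℝ} (hY : Measurable Y)
    (ν : Measure ℝ) [IsFiniteMeasure ν] :
    Integrable (fun y => variance (μ⟦{ω | y ≤ Y ω} | m⟧) μ) ν := by
  have hmeas : ∀ y, MeasurableSet {ω | y ≤ Y ω} := fun y => measurableSet_le measurable_const hY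
  have hL : ∀ y, MemLp (μ⟦{ω | y ≤ Y ω} | m⟧) 2 μ :=
    fun y => (memLp_indicator_one (hmeas y)).condExp (by norm_num)
  have hmono : ∀ y z, y ≤ z → μ⟦{ω | z ≤ Y ω} | m⟧ ≤ᵐ[μ] μ⟦{ω | y ≤ Y ω} | m⟧ :=
    fun y z hyz => condExp_indicator_one_mono (hmeas z) (hmeas y) fun ω hω => le_trans hyz hω
  have h1 : Antitone fun y => ∫ ω, (μ⟦{ω | y ≤ Y ω} | m⟧) ω ∂μ := fun y z hyz =>
    integral_mono_ae integrable_condExp integrable_condExp (hmono y z hyz)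
  have h2 : Antitone fun y => ∫ ω, ((μ⟦{ω | y ≤ Y ω} | m⟧) ^ 2) ω ∂μ := fun y z hyz => by
    refine integral_mono_ae (hL z).integrable_sq (hL y).integrable_sq ?_
    filter_upwards [hmono y z hyz, condExp_indicator_one_nonneg (m := m) {ω | z ≤ Y ω}]
      with ω hω hω'
    exact pow_le_pow_left₀ hω' hω 2
  refine Integrable.of_bound (C := 1) ?_ (Eventually.of_forall fun y => ?_)
  · have : (fun y => variance (μ⟦{ω | y ≤ Y ω} | m⟧) μ) = fun y =>
        ∫ ω, ((μ⟦{ω | y ≤ Y ω} | m⟧) ^ 2) ω ∂μ - (∫ ω, (μ⟦{ω | y ≤ Y ω} | m⟧) ω ∂μ) ^ 2 :=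
      funext fun y => variance_eq_sub (hL y)
    rw [this]
    exact (h2.measurable.sub (h1.measurable.pow_const 2)).aestronglyMeasurable
  · rw [Real.norm_of_nonneg (variance_nonneg _ _)]
    refine (variance_le_expectation_sq (hL y).aestronglyMeasurable).trans ?_
    have hle : ∫ ω, ((μ⟦{ω | y ≤ Y ω} | m⟧) ^ 2) ω ∂μ ≤ ∫ _, (1 : ℝ) ∂μ := by
      refine integral_mono_ae (hL y).integrable_sq (integrable_const 1) ?_
      have hone : μ⟦(Set.univ : Set Ω) | m⟧ = fun _ => 1 := by
        rw [Set.indicator_univ]; exact condExp_const hm 1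
      filter_upwards [condExp_indicator_one_nonneg (m := m) {ω | y ≤ Y ω},
        condExp_indicator_one_mono (m := m) (μ := μ) (hmeas y) .univ (Set.subset_univ _)]
        with ω h0 h1
      rw [hone] at h1
      exact pow_le_one₀ h0 h1
    simpa using hle

end CondExpVariance

section AlmostEveryThreshold

/-- If `S` has full measure, every half-line `[y, ∞)` is, up to small measure, either null or a
half-line `[w, ∞)` with `w ∈ S`. -/
lemma measure_Ici_lt_or_exists_measure_Ico_lt (ν : Measure ℝ) [IsFiniteMeasure ν] {S : Set ℝ}
    (hS : ν Sᶜ = 0) (y : ℝ) {ε : ℝ≥0∞} (hε : 0 < ε) :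
    ν (Set.Ici y) < ε ∨ ∃ w ∈ S, y ≤ w ∧ ν (Set.Ico y w) < ε := by
  rcases (S ∩ Set.Ici y).eq_empty_or_nonempty with hempty | hne
  · left
    rw [measure_mono_null (fun w hw hwS => hempty.subset ⟨hwS, hw⟩) hS]
    exact hε
  right
  have hbdd : BddBelow (S ∩ Set.Ici y) := ⟨y, fun w hw => hw.2⟩
  obtain ⟨u, hu, huS, hcof⟩ : ∃ u : ℕ → ℝ, Antitone u ∧ (∀ n, u n ∈ S ∩ Set.Ici y) ∧
      ∀ w ∈ S ∩ Set.Ici y, ∃ n, u n ≤ w := by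
    by_cases hmin : sInf (S ∩ Set.Ici y) ∈ S ∩ Set.Ici y
    · exact ⟨fun _ => sInf (S ∩ Set.Ici y), antitone_const, fun _ => hmin,
        fun w hw => ⟨0, csInf_le hbdd hw⟩⟩
    · obtain ⟨u, hu, hlim, huS⟩ := exists_seq_tendsto_sInf hne hbdd
      refine ⟨u, hu, huS, fun w hw => ?_⟩
      have hlt : sInf (S ∩ Set.Ici y) < w :=
        lt_of_le_of_ne (csInf_le hbdd hw) fun h => hmin (h ▸ hw)
      exact ((hlim.eventually (gt_mem_nhds hlt)).exists).imp fun n hn => le_of_lt hn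
  have hnull : ν (⋂ n, Set.Ico y (u n)) = 0 := by
    refine measure_mono_null (t := Sᶜ) (fun w hw hwS => ?_) hS
    rw [Set.mem_iInter] at hw
    obtain ⟨n, hn⟩ := hcof w ⟨hwS, (hw 0).1⟩
    exact (hw n).2.not_ge hn
  have hlim := tendsto_measure_iInter_atTop (μ := ν) (s := fun n => Set.Ico y (u n))
    (fun n => measurableSet_Ico.nullMeasurableSet)
    (fun a b hab => Set.Ico_subset_Ico_right (hu hab)) ⟨0, measure_ne_top _ _⟩
  rw [hnull] at hlim
  obtain ⟨n, hn⟩ := (hlim.eventually (gt_mem_nhds hε)).exists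
  exact ⟨u n, (huS n).1, (huS n).2, hn⟩

variable {Ω : Type*} {m m' m₀ : MeasurableSpace Ω} {μ : Measure Ω} [IsProbabilityMeasure μ]

/-- The class of events whose conditional probabilities given `m` and `m'` coincide is closed
under approximation in measure. -/
lemma condExp_eq_of_forall_approx {s : Set Ω} (hs : MeasurableSet s)
    (h : ∀ ε : ℝ≥0∞, 0 < ε → ∃ t ⊆ s, MeasurableSet t ∧ μ (s \ t) < ε ∧
      μ⟦t | m'⟧ =ᵐ[μ] μ⟦t | m⟧) :
    μ⟦s | m'⟧ =ᵐ[μ] μ⟦s | m⟧ := by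
  have hzero : eLpNorm (μ⟦s | m'⟧ - μ⟦s | m⟧) 1 μ = 0 := by
    refine le_antisymm (le_of_forall_pos_le_add fun ε hε => ?_) zero_le
    rw [zero_add]
    obtain ⟨t, hts, ht, hμ, heq⟩ := h (ε / 2) (ENNReal.half_pos hε.ne')
    have hdiff : MeasurableSet (s \ t) := hs.diff ht
    have hsplit : s.indicator (fun _ => (1 : ℝ)) =
        t.indicator (fun _ => (1 : ℝ)) + (s \ t).indicator (fun _ => (1 : ℝ)) := by
      ext ω
      by_cases hω : ω ∈ t
      · simp [hω, hts hω]
      · by_cases hω' : ω ∈ s <;> simp [hω, hω']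
    have hadd : ∀ M : MeasurableSpace Ω, μ⟦s | M⟧ =ᵐ[μ] μ⟦t | M⟧ + μ⟦s \ t | M⟧ := fun M => by
      rw [hsplit]
      exact condExp_add (integrable_indicator_one ht) (integrable_indicator_one hdiff) M
    have hrest : μ⟦s | m'⟧ - μ⟦s | m⟧ =ᵐ[μ] μ⟦s \ t | m'⟧ - μ⟦s \ t | m⟧ := by
      filter_upwards [hadd m, hadd m', heq] with ω h1 h2 h3
      simp only [Pi.sub_apply, h1, h2, Pi.add_apply, h3]
      ring
    have hbound : ∀ M : MeasurableSpace Ω, eLpNorm (μ⟦s \ t | M⟧) 1 μ ≤ ε / 2 := fun M => by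
      refine (eLpNorm_condExp_le_eLpNorm _ le_rfl).trans ?_
      rw [eLpNorm_indicator_const hdiff one_ne_zero ENNReal.one_ne_top]
      simpa using hμ.le
    rw [eLpNorm_congr_ae hrest]
    refine (eLpNorm_sub_le integrable_condExp.aestronglyMeasurable
      integrable_condExp.aestronglyMeasurable le_rfl).trans ?_
    exact (add_le_add (hbound m') (hbound m)).trans (ENNReal.add_halves ε).le
  rw [eLpNorm_eq_zero_iff (integrable_condExp.sub integrable_condExp).aestronglyMeasurable
    one_ne_zero] at hzero
  filter_upwards [hzero] with ω hω
  exact sub_eq_zero.mp hω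

lemma forall_condExp_eq_of_ae {Y : Ω → ℝ} (hY : Measurable Y)
    (h : ∀ᵐ y ∂(μ.map Y), μ⟦{ω | y ≤ Y ω} | m'⟧ =ᵐ[μ] μ⟦{ω | y ≤ Y ω} | m⟧) (y : ℝ) :
    μ⟦{ω | y ≤ Y ω} | m'⟧ =ᵐ[μ] μ⟦{ω | y ≤ Y ω} | m⟧ := by
  have : IsProbabilityMeasure (μ.map Y) := Measure.isProbabilityMeasure_map hY.aemeasurable
  have hmeas : ∀ y, MeasurableSet {ω | y ≤ Y ω} := fun y => measurableSet_le measurable_const hY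
  refine condExp_eq_of_forall_approx (hmeas y) fun ε hε => ?_
  rcases measure_Ici_lt_or_exists_measure_Ico_lt (μ.map Y) (ae_iff.mp h) y hε with
    hlt | ⟨w, hw, hyw, hlt⟩
  · refine ⟨∅, Set.empty_subset _, .empty, ?_, by simp⟩
    rw [Measure.map_apply hY measurableSet_Ici] at hlt
    rwa [Set.sdiff_empty]
  · refine ⟨{ω | w ≤ Y ω}, fun ω hω => le_trans hyw hω, hmeas w, ?_, hw⟩
    rw [Measure.map_apply hY measurableSet_Ico] at hlt
    refine lt_of_le_of_lt (measure_mono fun ω hω => ?_) hlt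
    exact ⟨hω.1, not_le.mp hω.2⟩

lemma integral_variance_condExp_mono (hmm' : m ≤ m') (hm' : m' ≤ m₀) {Y : Ω → ℝ}
    (hY : Measurable Y) :
    ∫ y, variance (μ⟦{ω | y ≤ Y ω} | m⟧) μ ∂(μ.map Y) ≤
      ∫ y, variance (μ⟦{ω | y ≤ Y ω} | m'⟧) μ ∂(μ.map Y) :=
  integral_mono (integrable_variance_condExp (hmm'.trans hm') hY _)
    (integrable_variance_condExp hm' hY _)
    fun _ => variance_condExp_mono hmm' hm'
      (memLp_indicator_one (measurableSet_le measurable_const hY))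

lemma integral_variance_condExp_eq_iff (hmm' : m ≤ m') (hm' : m' ≤ m₀) {Y : Ω → ℝ}
    (hY : Measurable Y) :
    ∫ y, variance (μ⟦{ω | y ≤ Y ω} | m⟧) μ ∂(μ.map Y) =
      ∫ y, variance (μ⟦{ω | y ≤ Y ω} | m'⟧) μ ∂(μ.map Y) ↔
    ∀ y, μ⟦{ω | y ≤ Y ω} | m'⟧ =ᵐ[μ] μ⟦{ω | y ≤ Y ω} | m⟧ := by
  have hL : ∀ y, MemLp ({ω | y ≤ Y ω}.indicator (fun _ => (1 : ℝ))) 2 μ :=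
    fun y => memLp_indicator_one (measurableSet_le measurable_const hY)
  rw [integral_eq_iff_of_ae_le (integrable_variance_condExp (hmm'.trans hm') hY _)
    (integrable_variance_condExp hm' hY _)
    (Eventually.of_forall fun y => variance_condExp_mono hmm' hm' (hL y))]
  refine ⟨fun h => forall_condExp_eq_of_ae hY ?_, fun h => Eventually.of_forall fun y => ?_⟩
  · filter_upwards [h] with y hy
    exact (variance_condExp_eq_iff hmm' hm' (hL y)).mp hy
  · exact (variance_condExp_eq_iff hmm' hm' (hL y)).mpr (h y)

end AlmostEveryThreshold

section RankCorrelation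

variable {Ω : Type*} {m m' B m₀ : MeasurableSpace Ω} {P : Measure Ω} [IsProbabilityMeasure P]
  {Y : Ω → ℝ}

lemma variance_condExp_bot (f : Ω → ℝ) : variance (P[f | ⊥]) P = 0 := by
  rw [condExp_bot]
  simp [variance_eq_integral aemeasurable_const]

lemma condExp_self_indicator_one {s : Set Ω} (hs : MeasurableSet s) :
    P⟦s | m₀⟧ = s.indicator (fun _ => (1 : ℝ)) :=
  condExp_of_stronglyMeasurable le_rfl (stronglyMeasurable_const.indicator hs)
    (integrable_indicator_one hs)

lemma integral_variance_condExp_self (hY : Measurable Y) :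
    ∫ y, variance (P⟦{ω | y ≤ Y ω} | m₀⟧) P ∂(P.map Y) =
      ∫ y, variance ({ω | y ≤ Y ω}.indicator (fun _ => (1 : ℝ))) P ∂(P.map Y) :=
  integral_congr_ae (Eventually.of_forall fun y => by
    simp only [condExp_self_indicator_one (P := P) (measurableSet_le measurable_const hY)])

lemma integral_variance_indicator_pos (hY : Measurable Y) (hnd : Nondegenerate P Y) :
    0 < ∫ y, variance ({ω | y ≤ Y ω}.indicator (fun _ => (1 : ℝ))) P ∂(P.map Y) := by
  refine lt_of_le_of_ne (integral_nonneg fun _ => variance_nonneg _ _) fun h => hnd ?_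
  have hbot : ∫ y, variance (P⟦{ω | y ≤ Y ω} | ⊥⟧) P ∂(P.map Y) = 0 := by
    simp only [variance_condExp_bot, integral_zero]
  rw [← hbot, ← integral_variance_condExp_self hY,
    integral_variance_condExp_eq_iff bot_le le_rfl hY] at h
  have : HasCountableSeparatingOn ℝ (· ∈ Set.range Set.Ici) Set.univ :=
    HasCountableSeparatingOn.range_Ici
  refine Filter.exists_eventuallyEq_const_of_forall_separating (l := ae P) (f := Y)
    (· ∈ Set.range Set.Ici) ?_
  rintro _ ⟨y, rfl⟩
  have hy := h y
  rw [condExp_self_indicator_one (measurableSet_le measurable_const hY), condExp_bot] at hy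
  by_cases hone : ∫ ω, {ω | y ≤ Y ω}.indicator (fun _ => (1 : ℝ)) ω ∂P = 1
  · left
    filter_upwards [hy] with ω hω
    by_contra hlt
    have hlt' : ¬ y ≤ Y ω := hlt
    simp [hlt', hone] at hω
  · right
    filter_upwards [hy] with ω hω hle
    have hle' : y ≤ Y ω := hle
    rw [Set.indicator_of_mem (by exact hle')] at hω
    exact hone hω.symm

lemma xiSigma_bot : xiSigma ⊥ P Y = 0 := by
  simp only [xiSigma, variance_condExp_bot, integral_zero, zero_div]

lemma xiSigma_mono (hmm' : m ≤ m') (hm' : m' ≤ m₀) (hY : Measurable Y) :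
    xiSigma m P Y ≤ xiSigma m' P Y :=
  div_le_div_of_nonneg_right (integral_variance_condExp_mono hmm' hm' hY)
    (integral_nonneg fun _ => variance_nonneg _ _)

lemma xiSigma_le_one (hm : m ≤ m₀) (hY : Measurable Y) : xiSigma m P Y ≤ 1 := by
  refine div_le_one_of_le₀ ?_ (integral_nonneg fun _ => variance_nonneg _ _)
  rw [← integral_variance_condExp_self hY]
  exact integral_variance_condExp_mono hm le_rfl hY

lemma xiSigma_sup_eq_iff_condIndep [StandardBorelSpace Ω] (hm : m ≤ m₀)
    (hB : B ≤ m₀) (hY : Measurable Y) (hnd : Nondegenerate P Y) :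
    xiSigma m P Y = xiSigma (m ⊔ B) P Y ↔
      CondIndep m (MeasurableSpace.comap Y inferInstance) B hm P := by
  unfold xiSigma
  rw [div_left_inj' (integral_variance_indicator_pos hY hnd).ne',
    integral_variance_condExp_eq_iff le_sup_left (sup_le hm hB) hY]
  refine ⟨condIndep_comap_of_forall_condExp_sup hY hm hB, fun h y => ?_⟩
  exact (condIndep_iff_condExp_sup hm hY.comap_le hB).mp h _ ⟨Set.Ici y, measurableSet_Ici, rfl⟩

end RankCorrelation

section ChainRule

variable {Ω : Type*} {m₀ : MeasurableSpace Ω} {P : Measure Ω} [IsProbabilityMeasure P]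

/-- Along an increasing family of σ-algebras, the conditional expectation is constant if and only
if its first and last values coincide. -/
lemma forall_condExp_succ_eq_iff {M : ℕ → MeasurableSpace Ω} (hM : Monotone M)
    (hle : ∀ k, M k ≤ m₀) (f : Ω → ℝ) (q : ℕ) :
    (∀ k < q, P[f | M (k + 1)] =ᵐ[P] P[f | M k]) ↔ P[f | M q] =ᵐ[P] P[f | M 0] := by
  constructor
  · intro h
    induction q with
    | zero => rfl
    | succ n ih => exact (h n n.lt_succ_self).trans (ih fun k hk => h k (hk.trans n.lt_succ_self))
  · intro h
    have key : ∀ k ≤ q, P[f | M k] =ᵐ[P] P[f | M 0] := fun k hk => by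
      have h1 : P[P[f | M q] | M k] =ᵐ[P] P[f | M k] := condExp_condExp_of_le (hM hk) (hle q)
      have h2 : P[P[f | M 0] | M k] = P[f | M 0] :=
        condExp_of_stronglyMeasurable (hle k)
          (stronglyMeasurable_condExp.mono (hM (Nat.zero_le k))) integrable_condExp
      exact h1.symm.trans ((condExp_congr_ae h).trans h2.eventuallyEq)
    exact fun k hk => (key (k + 1) hk).trans (key k hk.le).symm

/-- Chain rule for conditional independence along an increasing family of σ-algebras. -/
lemma forall_condIndep_iff_condIndep [StandardBorelSpace Ω] {q : ℕ}
    {M : ℕ → MeasurableSpace Ω} (hM : Monotone M) (hle : ∀ k, M k ≤ m₀)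
    {A : Fin q → MeasurableSpace Ω} (hA : ∀ i, A i ≤ m₀) (hMA : ∀ i : Fin q, M (i + 1) = M i ⊔ A i)
    {A' B : MeasurableSpace Ω} (hA' : A' ≤ m₀) (hMA' : M q = M 0 ⊔ A') (hB : B ≤ m₀) :
    (∀ i : Fin q, CondIndep (M i) (A i) B (hle i) P) ↔ CondIndep (M 0) A' B (hle 0) P := by
  have hswap : ∀ k (C : MeasurableSpace Ω), C ≤ m₀ → (CondIndep (M k) C B (hle k) P ↔
      ∀ s, MeasurableSet[B] s → P⟦s | M k ⊔ C⟧ =ᵐ[P] P⟦s | M k⟧) := fun k C hC => by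
    rw [← condIndep_iff_condExp_sup (hle k) hB hC]
    exact ⟨CondIndep.symm, CondIndep.symm⟩
  rw [hswap 0 A' hA', ← hMA']
  simp_rw [fun i : Fin q => hswap i (A i) (hA i), ← hMA]
  constructor
  · exact fun h s hs => (forall_condExp_succ_eq_iff hM hle _ q).mp fun k hk => h ⟨k, hk⟩ s hs
  · exact fun h i s hs => (forall_condExp_succ_eq_iff hM hle _ q).mpr (h s hs) i i.2

end ChainRule

section ResponseVector

variable {Ω : Type*} {q : ℕ}

/-- The σ-algebra generated by `m` and the response variables with index `< k`. -/
@[reducible]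
def sigmaPastSup (m : MeasurableSpace Ω) (Y : Fin q → Ω → ℝ) (k : ℕ) : MeasurableSpace Ω :=
  m ⊔ ⨆ j : Fin q, ⨆ _ : (j : ℕ) < k, MeasurableSpace.comap (Y j) inferInstance

lemma sigmaPastSup_mono (m : MeasurableSpace Ω) (Y : Fin q → Ω → ℝ) :
    Monotone (sigmaPastSup m Y) := fun _ _ hab =>
  sup_le_sup_left (iSup₂_le fun j hj =>
    le_iSup₂_of_le (f := fun (j : Fin q) (_ : (j : ℕ) < _) =>
      MeasurableSpace.comap (Y j) inferInstance) j (hj.trans_le hab) le_rfl) m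

lemma sigmaPastSup_zero (m : MeasurableSpace Ω) (Y : Fin q → Ω → ℝ) : sigmaPastSup m Y 0 = m := by
  simp [sigmaPastSup]

lemma sigmaPastSup_succ (m : MeasurableSpace Ω) (Y : Fin q → Ω → ℝ) (i : Fin q) :
    sigmaPastSup m Y (i + 1) =
      sigmaPastSup m Y i ⊔ MeasurableSpace.comap (Y i) inferInstance := by
  apply le_antisymm
  · refine sup_le (le_sup_left.trans le_sup_left) (iSup₂_le fun j hj => ?_)
    rcases (Nat.lt_succ_iff_lt_or_eq.mp hj) with h | h
    · exact le_sup_of_le_left (le_sup_of_le_right (le_iSup₂_of_le j h le_rfl))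
    · rw [Fin.ext h]; exact le_sup_right
  · exact sup_le (sigmaPastSup_mono m Y (Nat.le_succ _))
      (le_sup_of_le_right (le_iSup₂_of_le i (Nat.lt_succ_self _) le_rfl))

lemma sigmaPastSup_last (m : MeasurableSpace Ω) (Y : Fin q → Ω → ℝ) :
    sigmaPastSup m Y q = m ⊔ MeasurableSpace.comap (fun ω i => Y i ω) inferInstance := by
  have hpi : MeasurableSpace.comap (fun ω i => Y i ω) inferInstance =
      ⨆ j : Fin q, MeasurableSpace.comap (Y j) inferInstance := by
    simp only [MeasurableSpace.pi, MeasurableSpace.comap_iSup, MeasurableSpace.comap_comp]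
    rfl
  simp [sigmaPastSup, hpi]

lemma sigmaPastSup_le {m mΩ : MeasurableSpace Ω} (hm : m ≤ mΩ) {Y : Fin q → Ω → ℝ}
    (hY : ∀ i, Measurable (Y i)) (k : ℕ) : sigmaPastSup m Y k ≤ mΩ :=
  sup_le hm (iSup₂_le fun j _ => (hY j).comap_le)

variable [MeasurableSpace Ω] {P : Measure Ω} [IsProbabilityMeasure P]

lemma sum_xiSigma_sigmaPast_lt (hq : q ≠ 0) {Y : Fin q → Ω → ℝ} (hY : ∀ i, Measurable (Y i)) :
    ∑ i, xiSigma (sigmaPast Y i) P (Y i) < q := by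
  have : NeZero q := ⟨hq⟩
  have hone : ∑ _i : Fin q, (1 : ℝ) = q := by simp
  rw [← hone]
  refine Finset.sum_lt_sum (fun i _ => xiSigma_le_one ?_ (hY i)) ⟨0, Finset.mem_univ _, ?_⟩
  · exact iSup₂_le fun j _ => (hY j).comap_le
  · have hbot : sigmaPast Y 0 = ⊥ := by simp [sigmaPast]
    rw [hbot, xiSigma_bot]
    exact zero_lt_one

lemma T_eq_iff_sum_xiSigma_eq {α β : Type*} [MeasurableSpace α] [MeasurableSpace β]
    {Y : Fin q → Ω → ℝ} (hY : ∀ i, Measurable (Y i)) (X : Ω → α) (X' : Ω → β) :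
    T P Y X = T P Y X' ↔
      ∑ i, xiSigma (MeasurableSpace.comap X inferInstance ⊔ sigmaPast Y i) P (Y i) =
        ∑ i, xiSigma (MeasurableSpace.comap X' inferInstance ⊔ sigmaPast Y i) P (Y i) := by
  rcases eq_or_ne q 0 with rfl | hq
  · simp [T]
  · rw [T, T, sub_right_inj,
      div_left_inj' (sub_pos.mpr (sum_xiSigma_sigmaPast_lt hq hY)).ne', sub_right_inj]

end ResponseVector

theorem T_characterizes_conditional_independence
    {Ω : Type*} [MeasurableSpace Ω] [StandardBorelSpace Ω] [Nonempty Ω]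
    (P : Measure Ω) [IsProbabilityMeasure P]
    {p q r : ℕ} (X : Ω → (Fin p → ℝ)) (Z : Ω → (Fin r → ℝ)) (Y : Fin q → Ω → ℝ)
    (hX : Measurable X) (hZ : Measurable Z) (hY : ∀ i, Measurable (Y i))
    (hnd : ∀ i, Nondegenerate P (Y i)) :
    T P Y X = T P Y (fun ω => (X ω, Z ω)) ↔
      CondIndepFun (MeasurableSpace.comap X inferInstance) hX.comap_le
        (fun ω => fun i => Y i ω) Z P := by
  have hle := sigmaPastSup_le hX.comap_le hY
  have hsup : ∀ i, MeasurableSpace.comap (fun ω => (X ω, Z ω)) inferInstance ⊔ sigmaPast Y i =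
      sigmaPastSup (MeasurableSpace.comap X inferInstance) Y i ⊔
        MeasurableSpace.comap Z inferInstance := fun i => by
    refine (congrArg (· ⊔ sigmaPast Y i) (MeasurableSpace.comap_prodMk X Z)).trans ?_
    exact sup_right_comm _ _ _
  have hchain := forall_condIndep_iff_condIndep (P := P)
    (sigmaPastSup_mono (MeasurableSpace.comap X inferInstance) Y) hle
    (A := fun i => MeasurableSpace.comap (Y i) inferInstance) (fun i => (hY i).comap_le)
    (sigmaPastSup_succ _ Y) (A' := MeasurableSpace.comap (fun ω i => Y i ω) inferInstance)
    (measurable_pi_lambda _ hY).comap_le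
    (by rw [sigmaPastSup_last, sigmaPastSup_zero]) hZ.comap_le
  simp only [sigmaPastSup_zero] at hchain
  rw [condIndepFun_iff_condIndep, ← hchain, T_eq_iff_sum_xiSigma_eq hY]
  simp only [hsup]
  refine (Finset.sum_eq_sum_iff_of_le fun (i : Fin q) _ =>
    xiSigma_mono le_sup_left (sup_le (hle (i : ℕ)) hZ.comap_le) (hY i)).trans ?_
  simp only [Finset.mem_univ, true_imp_iff]
  exact forall_congr' fun i => xiSigma_sup_eq_iff_condIndep (hle i) hZ.comap_le (hY i) (hnd i)
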